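/- Let γ: ℝ/L → ℝ³ be a minimal inspection curve with unfolding γ̃, and let σ: [a,b] → ℝ² be a strict spiral occurring in a spiral decomposition of γ̃. Let t ∈ [a,b] be a regular point of both σ and γ, and let ℓ be the tangent line of σ at t. If ℓ crosses the unit circle S¹ ⊂ ℝ² (i.e., ℓ meets the open unit disk), then σ([a,t]) is contained in ℓ. -/

import Mathlib

open Real Set MeasureTheory ENNReal

noncomputable section


noncomputable section

abbrev E3 := EuclideanSpace ℝ (Fin 3)

/-- The lift of a curve `γ : ℝ/L → ℝ³` to `ℝ`, via the quotient map `ℝ → ℝ/L`. -/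
def liftCurve (L : ℝ) (γ : AddCircle L → E3) : ℝ → E3 := fun s => γ s

/-- An inspection curve is a closed rectifiable curve `γ : ℝ/L → ℝ³`, parameterized with
constant unit speed (`1`-Lipschitz with total variation `L` over one period), whose convex
hull contains the unit sphere centered at the origin. -/
def IsInspectionCurve (L : ℝ) (γ : AddCircle L → E3) : Prop :=
  0 < L ∧ Continuous γ ∧ LipschitzWith 1 (liftCurve L γ) ∧
    eVariationOn (liftCurve L γ) (Set.Icc 0 L) = ENNReal.ofReal L ∧
    Metric.sphere (0 : E3) 1 ⊆ convexHull ℝ (Set.range γ)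

/-- A minimal inspection curve is an inspection curve of minimal length. -/
def IsMinInspectionCurve (L : ℝ) (γ : AddCircle L → E3) : Prop :=
  IsInspectionCurve L γ ∧
    ∀ (L' : ℝ) (γ' : AddCircle L' → E3), IsInspectionCurve L' γ' → L ≤ L'

/-- The (almost-everywhere defined) derivative of the radial projection
`γ̄ = γ/|γ| : ℝ → S²` of the lifted curve. -/
def projDeriv (L : ℝ) (γ : AddCircle L → E3) : ℝ → E3 :=
  deriv fun s : ℝ => ‖liftCurve L γ s‖⁻¹ • liftCurve L γ s

/-- The arclength function `θ(t) = ∫₀ᵗ |γ̄'(s)| ds` of the radial projection of `γ`. -/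
def thetaFn (L : ℝ) (γ : AddCircle L → E3) (t : ℝ) : ℝ :=
  ∫ u in (0:ℝ)..t, ‖projDeriv L γ u‖

/-- `γt : [0,L] → ℝ² ≅ ℂ` is the unfolding of `γ : ℝ/L → ℝ³`: for the finitely many times
`0 = t₀ < t₁ < ⋯ < t_m = L` at which `γ` passes through the origin (together with the
distinguished endpoints `0` and `L`), one has
`γt(s) = |γ(s)| · e^{i(θ(s) + (k-1)π)}` for `s ∈ [t_{k-1}, t_k]`. -/
def IsUnfolding (L : ℝ) (γ : AddCircle L → E3) (γt : ℝ → ℂ) : Prop :=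
  ∃ (m : ℕ) (tk : ℕ → ℝ), 0 < m ∧ StrictMonoOn tk (Set.Iic m) ∧
    tk 0 = 0 ∧ tk m = L ∧
    (∀ s ∈ Set.Ioo (0:ℝ) L,
      (liftCurve L γ s = 0 ↔ ∃ k : ℕ, 0 < k ∧ k < m ∧ s = tk k)) ∧
    (∀ k : ℕ, 1 ≤ k → k ≤ m → ∀ s ∈ Set.Icc (tk (k-1)) (tk k),
      γt s = (‖liftCurve L γ s‖ : ℂ) *
        Complex.exp (Complex.I * Complex.ofReal (thetaFn L γ s + ((k : ℝ) - 1) * π)))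

/-- The Euclidean dot product on `ℝ² ≅ ℂ`. -/
def dot2 (x y : ℂ) : ℝ := x.re * y.re + x.im * y.im

/-- `σ` has, at the point `σ t`, a local support line lying above `σ` (relative to the
domain `D`): a line through `σ t` (with normal `n ≠ 0`) such that a neighborhood of `t`
in `D` is mapped into the side of the line containing the origin `o`. -/
def HasLocalSupportLineAbove (σ : ℝ → ℂ) (D : Set ℝ) (t : ℝ) : Prop :=
  ∃ n : ℂ, n ≠ 0 ∧ 0 ≤ dot2 n (σ t) ∧
    ∃ U ∈ nhdsWithin t D, ∀ s ∈ U, dot2 n (σ s) ≤ dot2 n (σ t)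

/-- A planar curve `σ` is locally convex with respect to the origin `o` on `D` if it is
locally one-to-one on `D` and through each of its points there passes a local support
line which lies above `σ` (i.e. with the nearby part of `σ` on the side containing `o`). -/
def LocConvexWrtOrigin (σ : ℝ → ℂ) (D : Set ℝ) : Prop :=
  (∀ t ∈ D, ∃ U ∈ nhdsWithin t D, Set.InjOn σ U) ∧
  (∀ t ∈ D, HasLocalSupportLineAbove σ D t)

/-- A (generalized) spiral: a constant-speed planar curve `σ : [a,b] → ℝ² ≅ ℂ` which is
(i) locally convex with respect to the origin, (ii) has `|σ|` nondecreasing, and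
(iii) satisfies `⟨σ(a), σ'₊(a)⟩ = 0` for the one-sided derivative at `a`. -/
def IsSpiral (σ : ℝ → ℂ) (a b : ℝ) : Prop :=
  a < b ∧ ContinuousOn σ (Set.Icc a b) ∧
  (∃ c : ℝ, ∀ᵐ s ∂(volume.restrict (Set.Icc a b)),
    ∃ v : ℂ, HasDerivAt σ v s ∧ ‖v‖ = c) ∧
  LocConvexWrtOrigin σ (Set.Icc a b) ∧
  MonotoneOn (fun s => ‖σ s‖) (Set.Icc a b) ∧
  ∃ v : ℂ, HasDerivWithinAt σ v (Set.Ici a) a ∧ dot2 (σ a) v = 0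

/-- A strict spiral: a spiral with `|σ|` strictly increasing. -/
def IsStrictSpiral (σ : ℝ → ℂ) (a b : ℝ) : Prop :=
  IsSpiral σ a b ∧ StrictMonoOn (fun s => ‖σ s‖) (Set.Icc a b)

/-- A spiral decomposition of a planar curve `γt : [0,L] → ℝ² ≅ ℂ`: a collection of
mutually disjoint (relatively) open subsets `U i` of `[0,L]` such that each restriction
of `γt` to `cl (U i) = [aᵢ, bᵢ]` is a strict spiral, after reversing direction if
necessary, and `|γt|' = 0` almost everywhere off `⋃ i, cl (U i)`. -/
def IsSpiralDecomp (L : ℝ) (γt : ℝ → ℂ) (ι : Type) (U : ι → Set ℝ) : Prop :=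
  Pairwise (Function.onFun Disjoint U) ∧
  (∀ i, ∃ V : Set ℝ, IsOpen V ∧ U i = V ∩ Set.Icc 0 L) ∧
  (∀ i, ∃ a b : ℝ, closure (U i) = Set.Icc a b ∧
    (IsStrictSpiral γt a b ∨ IsStrictSpiral (fun s => γt (a + b - s)) a b)) ∧
  (∀ᵐ s ∂(volume.restrict (Set.Icc 0 L \ ⋃ i, closure (U i))),
    HasDerivAt (fun u => ‖γt u‖) 0 s)

theorem isCompact_convexHull_of_finiteDimensional {E : Type*} [NormedAddCommGroup E]
    [NormedSpace ℝ E] [FiniteDimensional ℝ E] {s : Set E} (hs : IsCompact s) :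
    IsCompact (convexHull ℝ s) := by
  have key : convexHull ℝ s = ⋃ n ∈ Finset.range (Module.finrank ℝ E + 2),
      (fun q : (Fin n → ℝ) × (Fin n → E) => ∑ j, q.1 j • q.2 j) ''
        (stdSimplex ℝ (Fin n) ×ˢ Set.univ.pi fun _ => s) := by
    apply subset_antisymm
    · intro x hx
      obtain ⟨κ, _, z, c, hz, hind, hc, hc1, hcx⟩ := eq_pos_convex_span_of_mem_convexHull hx
      have hcard : Fintype.card κ ≤ Module.finrank ℝ E + 1 :=
        hind.card_le_finrank_succ.trans (Nat.succ_le_succ (Submodule.finrank_le _))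
      let e := (Fintype.equivFin κ).symm
      simp only [Set.mem_iUnion, Finset.mem_range]
      refine ⟨Fintype.card κ, by omega, (c ∘ e, z ∘ e), ⟨⟨fun j => (hc _).le, ?_⟩, ?_⟩, ?_⟩
      · simpa using (e.sum_comp c).trans hc1
      · exact fun j _ => hz ⟨_, rfl⟩
      · exact (e.sum_comp fun k => c k • z k).trans hcx
    · simp only [Set.iUnion_subset_iff]
      rintro n - x ⟨⟨c, z⟩, ⟨⟨hc, hc1⟩, hz⟩, rfl⟩
      exact (convex_convexHull ℝ s).sum_mem (fun j _ => hc j) hc1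
        fun j _ => subset_convexHull ℝ s (hz j trivial)
  rw [key]
  refine (Finset.range _).isCompact_biUnion fun n _ => ?_
  refine ((isCompact_stdSimplex ℝ (Fin n)).prod (isCompact_univ_pi fun _ => hs)).image ?_
  fun_prop

theorem ball_subset_interior_of_sphere_subset {K : Set E3} (hK : Convex ℝ K)
    (h : Metric.sphere (0 : E3) 1 ⊆ K) : Metric.ball (0 : E3) 1 ⊆ interior K := by
  apply interior_maximal _ Metric.isOpen_ball
  refine Metric.ball_subset_closedBall.trans ?_
  rw [← convexHull_sphere_eq_closedBall (0 : E3) zero_le_one]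
  exact convexHull_min h hK

/-- The convex hull of a compact set `s` is contained in that of any nonempty compact set which
contains the points of `s` outside the interior of the hull. -/
theorem subset_convexHull_of_diff_interior_subset {E : Type*} [NormedAddCommGroup E]
    [NormedSpace ℝ E] [FiniteDimensional ℝ E] {s s' : Set E} (hs : IsCompact s)
    (hs' : IsCompact s') (hss : s \ interior (convexHull ℝ s) ⊆ s') (hne : s'.Nonempty) :
    convexHull ℝ s ⊆ convexHull ℝ s' := by
  intro x hx
  by_contra hxn
  obtain ⟨f, u, hfu, hux⟩ := geometric_hahn_banach_closed_point (convex_convexHull ℝ s')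
    (isCompact_convexHull_of_finiteDimensional hs').isClosed hxn
  have hsne : s.Nonempty := convexHull_nonempty_iff.1 ⟨x, hx⟩
  obtain ⟨y, hys, hymax⟩ := hs.exists_isMaxOn hsne f.continuous.continuousOn
  have hle : ∀ z ∈ convexHull ℝ s, f z ≤ f y := by
    intro z hz
    exact convexHull_min (t := {z | f z ≤ f y}) (fun z hz => hymax hz)
      (convex_halfSpace_le f.isLinear _) hz
  have hy : y ∉ interior (convexHull ℝ s) := by
    intro hy
    have hloc : IsLocalMax f y := by
      filter_upwards [mem_interior_iff_mem_nhds.1 hy] with z hz using hle z hz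
    have hf0 : f = 0 := hloc.hasFDerivAt_eq_zero f.hasFDerivAt
    obtain ⟨z, hz⟩ := hne
    have := hfu z (subset_convexHull ℝ s' hz)
    simp [hf0] at this hux
    linarith
  have h1 := hfu y (subset_convexHull ℝ s' (hss ⟨hys, hy⟩))
  have h2 := hle x hx
  linarith

/-- If the tangent line of a curve at a point meets the interior of its convex hull, then the point
is itself interior to the convex hull. -/
theorem mem_interior_of_tangent_meets {E : Type*} [NormedAddCommGroup E]
    [NormedSpace ℝ E] {K : Set E} (hK : Convex ℝ K) {g : ℝ → E} (hg : ∀ s, g s ∈ K)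
    {t : ℝ} {w : E} (hw : HasDerivAt g w t) {u : ℝ} (hu : g t + u • w ∈ interior K) :
    g t ∈ interior K := by
  by_contra hn
  obtain ⟨f, hf⟩ := geometric_hahn_banach_open_point hK.interior isOpen_interior hn
  have hle : ∀ z ∈ K, f z ≤ f (g t) := by
    intro z hz
    have hz' : z ∈ closure (interior K) := by
      rw [hK.closure_interior_eq_closure_of_nonempty_interior ⟨_, hu⟩]
      exact subset_closure hz
    exact closure_minimal (fun y hy => (hf y hy).le)
      (isClosed_le f.continuous continuous_const) hz'
  have hmax : IsLocalMax (fun s => f (g s)) t := Filter.Eventually.of_forall fun s => hle _ (hg s)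
  have h0 : f w = 0 := hmax.hasDerivAt_eq_zero (f.hasFDerivAt.comp_hasDerivAt t hw)
  have := hf _ hu
  simp [h0] at this

theorem LipschitzOnWith.Icc_union {E : Type*} [PseudoMetricSpace E] {f : ℝ → E} {x y z : ℝ}
    (h₁ : LipschitzOnWith 1 f (Icc x y)) (h₂ : LipschitzOnWith 1 f (Icc y z)) :
    LipschitzOnWith 1 f (Icc x z) := by
  have key : ∀ p ∈ Icc x z, ∀ q ∈ Icc x z, p ≤ q → dist (f p) (f q) ≤ q - p := by
    intro p hp q hq hpq
    have d₁ := fun r s hr hs => h₁.dist_le_mul (x := r) hr (y := s) hs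
    have d₂ := fun r s hr hs => h₂.dist_le_mul (x := r) hr (y := s) hs
    simp only [NNReal.coe_one, one_mul, Real.dist_eq] at d₁ d₂
    rcases le_total q y with hqy | hqy
    · have := d₁ p q ⟨hp.1, hpq.trans hqy⟩ ⟨hq.1, hqy⟩
      rwa [abs_sub_comm, abs_of_nonneg (by linarith)] at this
    rcases le_total y p with hyp | hyp
    · have := d₂ p q ⟨hyp, hp.2⟩ ⟨hqy, hq.2⟩
      rwa [abs_sub_comm, abs_of_nonneg (by linarith)] at this
    · have e₁ := d₁ p y ⟨hp.1, hyp⟩ ⟨hp.1.trans hyp, le_rfl⟩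
      have e₂ := d₂ y q ⟨le_rfl, hqy.trans hq.2⟩ ⟨hqy, hq.2⟩
      rw [abs_sub_comm, abs_of_nonneg (by linarith)] at e₁ e₂
      linarith [dist_triangle (f p) (f y) (f q)]
  refine LipschitzOnWith.of_dist_le_mul fun p hp q hq => ?_
  rw [NNReal.coe_one, one_mul, Real.dist_eq]
  rcases le_total p q with h | h
  · rw [abs_sub_comm, abs_of_nonneg (by linarith)]
    exact key p hp q hq h
  · rw [dist_comm, abs_of_nonneg (by linarith)]
    exact key q hq p hp h

theorem LipschitzOnWith.eVariationOn_Icc_le {E : Type*} [PseudoEMetricSpace E] {f : ℝ → E}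
    {x y : ℝ} (hf : LipschitzOnWith 1 f (Icc x y)) (hxy : x ≤ y) :
    eVariationOn f (Icc x y) ≤ ENNReal.ofReal (y - x) := by
  have h1 := hf.comp_eVariationOn_le (f := f) (g := (id : ℝ → ℝ)) (s := Icc x y)
    (fun _ h => h)
  have h2 := (monotone_id.monotoneOn (Icc x y)).eVariationOn_eq
    (left_mem_Icc.2 hxy) (right_mem_Icc.2 hxy)
  rw [inter_self] at h2
  simpa using h1.trans (mul_le_mul_right h2.le _)

theorem eVariationOn_Icc_add_Icc {E : Type*} [PseudoEMetricSpace E] (f : ℝ → E)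
    {x y z : ℝ} (hxy : x ≤ y) (hyz : y ≤ z) :
    eVariationOn f (Icc x y) + eVariationOn f (Icc y z) = eVariationOn f (Icc x z) := by
  simpa using eVariationOn.Icc_add_Icc f (s := univ) hxy hyz trivial

/-- A `1`-Lipschitz curve of unit speed on an interval has unit speed on subintervals. -/
theorem eVariationOn_Icc_eq_of_subinterval {E : Type*} [PseudoEMetricSpace E] {f : ℝ → E}
    {A B x y : ℝ} (hf : LipschitzOnWith 1 f (Icc A B))
    (hvar : eVariationOn f (Icc A B) = ENNReal.ofReal (B - A))
    (hAx : A ≤ x) (hxy : x ≤ y) (hyB : y ≤ B) :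
    eVariationOn f (Icc x y) = ENNReal.ofReal (y - x) := by
  have hv1 := (hf.mono (Icc_subset_Icc_right (hxy.trans hyB))).eVariationOn_Icc_le hAx
  have hv2 := (hf.mono (Icc_subset_Icc hAx hyB)).eVariationOn_Icc_le hxy
  have hv3 := (hf.mono (Icc_subset_Icc_left (hAx.trans hxy))).eVariationOn_Icc_le hyB
  refine le_antisymm hv2 ?_
  rw [← eVariationOn_Icc_add_Icc f hAx (hxy.trans hyB),
    ← eVariationOn_Icc_add_Icc f hxy hyB] at hvar
  have hsum : ENNReal.ofReal (B - A) = ENNReal.ofReal (x - A) +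
      (ENNReal.ofReal (y - x) + ENNReal.ofReal (B - y)) := by
    rw [← ENNReal.ofReal_add (by linarith) (by linarith),
      ← ENNReal.ofReal_add (by linarith) (by linarith)]
    congr 1; ring
  have h : ENNReal.ofReal (x - A) + (ENNReal.ofReal (y - x) + ENNReal.ofReal (B - y)) ≤
      ENNReal.ofReal (x - A) + (eVariationOn f (Icc x y) + ENNReal.ofReal (B - y)) := by
    rw [← hsum, ← hvar]
    gcongr
  have h := (ENNReal.add_le_add_iff_left ENNReal.ofReal_ne_top).1 h
  exact (ENNReal.add_le_add_iff_right ENNReal.ofReal_ne_top).1 h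

theorem Function.Periodic.lipschitzWith_one {E : Type*} [PseudoMetricSpace E] {f : ℝ → E}
    {L : ℝ} (hL : 0 < L) (hper : Function.Periodic f L) (hf : LipschitzOnWith 1 f (Icc 0 L)) :
    LipschitzWith 1 f := by
  have hn : ∀ n : ℤ, ∀ p ∈ Icc (n * L) ((n + 1) * L), ∀ q ∈ Icc (n * L) ((n + 1) * L),
      dist (f p) (f q) ≤ |p - q| := by
    intro n p hp q hq
    have h := hf.dist_le_mul (p - n * L) ⟨by linarith [hp.1], by linarith [hp.2]⟩
      (q - n * L) ⟨by linarith [hq.1], by linarith [hq.2]⟩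
    rw [hper.sub_int_mul_eq, hper.sub_int_mul_eq] at h
    simpa [Real.dist_eq] using h
  have hfloor : ∀ x : ℝ, x ∈ Icc (⌊x / L⌋ * L) ((⌊x / L⌋ + 1) * L) := fun x =>
    ⟨(le_div_iff₀ hL).1 (Int.floor_le _), ((div_lt_iff₀ hL).1 (Int.lt_floor_add_one _)).le⟩
  have hmul : ∀ n : ℤ, f (n * L) = f 0 := fun n => by
    simpa using hper.int_mul_eq n
  have key : ∀ p q, p ≤ q → dist (f p) (f q) ≤ q - p := by
    intro p q hpq
    have hp := hfloor p
    have hq := hfloor q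
    have hfl : ⌊p / L⌋ ≤ ⌊q / L⌋ := Int.floor_mono (div_le_div_of_nonneg_right hpq hL.le)
    rcases hfl.eq_or_lt with he | hlt
    · have := hn _ p hp q (he ▸ hq)
      rwa [abs_sub_comm, abs_of_nonneg (by linarith)] at this
    · have h1 := hn _ p hp ((⌊p / L⌋ + 1) * L) ⟨by nlinarith, le_rfl⟩
      have h2 := hn _ (⌊q / L⌋ * L) ⟨le_rfl, by nlinarith⟩ q hq
      have e1 : f ((⌊p / L⌋ + 1) * L) = f 0 := by
        have := hmul (⌊p / L⌋ + 1)
        push_cast at this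
        exact this
      rw [e1, abs_sub_comm, abs_of_nonneg (by linarith [hp.2])] at h1
      rw [hmul, abs_sub_comm, abs_of_nonneg (by linarith [hq.1])] at h2
      have hle : ((⌊p / L⌋ : ℝ) + 1) * L ≤ ⌊q / L⌋ * L := by
        apply mul_le_mul_of_nonneg_right _ hL.le
        exact_mod_cast hlt
      linarith [dist_triangle (f p) (f 0) (f q)]
  refine LipschitzWith.of_dist_le_mul fun p q => ?_
  rw [NNReal.coe_one, one_mul, Real.dist_eq]
  rcases le_total p q with h | h
  · rw [abs_sub_comm, abs_of_nonneg (by linarith)]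
    exact key p q h
  · rw [dist_comm, abs_of_nonneg (by linarith)]
    exact key q p h

theorem liftCurve_periodic (L : ℝ) (γ : AddCircle L → E3) :
    Function.Periodic (liftCurve L γ) L := fun s => by
  simp [liftCurve]

theorem IsMinInspectionCurve.le_of_closed_path {L : ℝ} {γ : AddCircle L → E3}
    (h : IsMinInspectionCurve L γ) {L' : ℝ} (hL' : 0 < L') {F : ℝ → E3}
    (hF : LipschitzOnWith 1 F (Icc 0 L')) (hclosed : F 0 = F L')
    (hvar : eVariationOn F (Icc 0 L') = ENNReal.ofReal L')
    (hsph : Metric.sphere (0 : E3) 1 ⊆ convexHull ℝ (F '' Icc 0 L')) : L ≤ L' := by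
  have : Fact (0 < L') := ⟨hL'⟩
  have heq : EqOn (liftCurve L' (AddCircle.liftIco L' 0 F)) F (Icc 0 L') := by
    intro s hs
    rcases hs.2.eq_or_lt with rfl | hlt
    · have : ((s : ℝ) : AddCircle s) = ((0 : ℝ) : AddCircle s) := by simp
      simp only [liftCurve]
      rw [this, AddCircle.liftIco_zero_coe_apply ⟨le_rfl, hL'⟩, hclosed]
    · exact AddCircle.liftIco_zero_coe_apply ⟨hs.1, hlt⟩
  refine h.2 L' (AddCircle.liftIco L' 0 F) ⟨hL',
    AddCircle.liftIco_zero_continuous hclosed hF.continuousOn,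
    (liftCurve_periodic _ _).lipschitzWith_one hL' ?_, ?_, ?_⟩
  · exact fun x hx y hy => by rw [heq hx, heq hy]; exact hF hx hy
  · rw [eVariationOn.congr heq, hvar]
  · refine hsph.trans (convexHull_mono ?_)
    rintro _ ⟨s, hs, rfl⟩
    exact ⟨(s : AddCircle L'), heq hs⟩

theorem IsInspectionCurve.eVariationOn_wrap {L : ℝ} {γ : AddCircle L → E3}
    (h : IsInspectionCurve L γ) {p q : ℝ} (hp : 0 ≤ p) (hpq : p ≤ q) (hq : q ≤ L) :
    eVariationOn (liftCurve L γ) (Icc q (p + L)) = ENNReal.ofReal (p + L - q) := by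
  obtain ⟨hL, -, hlip, hvar, -⟩ := h
  have hvar' : eVariationOn (liftCurve L γ) (Icc 0 L) = ENNReal.ofReal (L - 0) := by
    simpa using hvar
  have h1 := eVariationOn_Icc_eq_of_subinterval hlip.lipschitzOnWith hvar' (hp.trans hpq) hq le_rfl
  have h2 := eVariationOn_Icc_eq_of_subinterval hlip.lipschitzOnWith hvar' le_rfl hp (hpq.trans hq)
  have h3 : eVariationOn (liftCurve L γ) (Icc L (p + L)) = eVariationOn (liftCurve L γ) (Icc 0 p) := by
    have := eVariationOn.comp_eq_of_monotoneOn (liftCurve L γ) (t := Icc 0 p) (fun s => s + L)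
      (fun x _ y _ hxy => by simpa using hxy)
    rw [image_add_const_Icc, zero_add] at this
    rw [← this]
    congr 1
    exact funext fun s => liftCurve_periodic L γ s
  rw [← eVariationOn_Icc_add_Icc _ hq (by linarith : L ≤ p + L), h1, h3, h2,
    ← ENNReal.ofReal_add (by linarith) (by linarith)]
  congr 1; ring

/-- A minimal inspection curve is straight where it runs in the interior of its convex hull. -/
theorem IsMinInspectionCurve.dist_eq_of_mem_interior {L : ℝ} {γ : AddCircle L → E3}
    (h : IsMinInspectionCurve L γ) {p q : ℝ} (hp : 0 ≤ p) (hpq : p ≤ q) (hq : q ≤ L)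
    (hlt : q - p < L)
    (hint : ∀ s ∈ Icc p q, liftCurve L γ s ∈ interior (convexHull ℝ (range γ))) :
    dist (liftCurve L γ p) (liftCurve L γ q) = q - p := by
  obtain ⟨hL, hcont, hlip, hvar, hsph⟩ := h.1
  set f := liftCurve L γ with hf
  set d := dist (f p) (f q) with hd
  set c := p + L - q with hc
  have hc0 : 0 < c := by linarith
  have hd0 : 0 ≤ d := dist_nonneg
  have hdle : d ≤ q - p := by
    have := hlip.dist_le_mul p q
    rwa [NNReal.coe_one, one_mul, Real.dist_eq, abs_sub_comm, abs_of_nonneg (by linarith)] at this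
  suffices hLL : L ≤ c + d by linarith
  set e : E3 := d⁻¹ • (f q - f p) with he
  have hnorm : ‖f q - f p‖ = d := by rw [hd, dist_eq_norm, norm_sub_rev]
  have hde : d • e = f q - f p := by
    rcases eq_or_ne d 0 with h0 | h0
    · rw [h0, zero_smul]
      exact (norm_eq_zero.1 (hnorm.trans h0)).symm
    · rw [he, smul_inv_smul₀ h0]
  have he1 : ‖e‖ ≤ 1 := by
    rw [he, norm_smul, hnorm, norm_inv, Real.norm_of_nonneg hd0]
    exact inv_mul_le_one
  set F : ℝ → E3 := fun s => if s ≤ c then f (s + q) else f p + (s - c) • e with hF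
  have hfc : f (c + q) = f p := by
    rw [show c + q = p + L by rw [hc]; ring]
    exact liftCurve_periodic L γ p
  have hF1 : EqOn F (fun s => f (s + q)) (Icc 0 c) := fun s hs => by simp [hF, hs.2]
  have hF2 : EqOn F (fun s => f p + (s - c) • e) (Icc c (c + d)) := fun s hs => by
    rcases hs.1.eq_or_lt with rfl | hlt
    · simp [hF, hfc]
    · simp [hF, not_le.2 hlt]
  have hlip1 : LipschitzOnWith 1 F (Icc 0 c) := by
    intro x hx y hy
    rw [hF1 hx, hF1 hy]
    simpa using hlip (x + q) (y + q)
  have hlip2 : LipschitzOnWith 1 F (Icc c (c + d)) := by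
    refine LipschitzOnWith.of_dist_le_mul fun x hx y hy => ?_
    rw [hF2 hx, hF2 hy, dist_eq_norm, Real.dist_eq, NNReal.coe_one, one_mul]
    have : f p + (x - c) • e - (f p + (y - c) • e) = (x - y) • e := by module
    rw [this, norm_smul, Real.norm_eq_abs]
    exact mul_le_of_le_one_right (abs_nonneg _) he1
  have hFc : F c = f p := by rw [hF2 ⟨le_rfl, by linarith⟩]; simp
  have hFd : F (c + d) = f q := by
    rw [hF2 ⟨by linarith, le_rfl⟩]
    simp [hde]
  have hF0 : F 0 = f q := by rw [hF1 ⟨le_rfl, hc0.le⟩]; simp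
  refine h.le_of_closed_path (by linarith) (hlip1.Icc_union hlip2) (hF0.trans hFd.symm) ?_ ?_
  · rw [← eVariationOn_Icc_add_Icc F hc0.le (by linarith : c ≤ c + d),
      ENNReal.ofReal_add hc0.le hd0]
    congr 1
    · rw [eVariationOn.congr hF1, ← h.1.eVariationOn_wrap hp hpq hq]
      have := eVariationOn.comp_eq_of_monotoneOn f (t := Icc 0 c) (fun s => s + q)
        (fun x _ y _ hxy => by simpa using hxy)
      rw [image_add_const_Icc, zero_add, show c + q = p + L by rw [hc]; ring] at this
      exact this
    · refine le_antisymm ?_ ?_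
      · simpa using hlip2.eVariationOn_Icc_le (by linarith)
      · have := eVariationOn.edist_le F (s := Icc c (c + d)) (x := c) (y := c + d)
          ⟨le_rfl, by linarith⟩ ⟨by linarith, le_rfl⟩
        rwa [hFc, hFd, edist_dist] at this
  · have hcpt : IsCompact (range γ) := by
      have : Fact (0 < L) := ⟨hL⟩
      exact isCompact_range hcont
    refine hsph.trans (subset_convexHull_of_diff_interior_subset hcpt
      (isCompact_Icc.image_of_continuousOn (hlip1.Icc_union hlip2).continuousOn) ?_
      ⟨_, 0, ⟨le_rfl, by linarith⟩, rfl⟩)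
    rintro _ ⟨⟨x, rfl⟩, hx⟩
    have : Fact (0 < L) := ⟨hL⟩
    obtain ⟨s, hs, rfl⟩ := AddCircle.coe_image_Ico_eq L p ▸ mem_univ x
    have hqs : q < s := by
      by_contra hsq
      exact hx (hint s ⟨hs.1, not_lt.1 hsq⟩)
    have hsm : s - q ∈ Icc 0 c := ⟨by linarith, by linarith [hs.2]⟩
    refine ⟨s - q, ⟨hsm.1, by linarith [hsm.2]⟩, ?_⟩
    rw [hF1 hsm]
    simp [hf, liftCurve]

/-- A curve which preserves distances on `(c, t]` runs on its tangent line at `t`. -/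
theorem eq_add_smul_of_dist_eq {E : Type*} [NormedAddCommGroup E] [InnerProductSpace ℝ E]
    {g : ℝ → E} {c t : ℝ} (hct : c < t) (hcont : Continuous g)
    (hdist : ∀ p q, c < p → p ≤ q → q ≤ t → dist (g p) (g q) = q - p)
    {w : E} (hw : HasDerivAt g w t) :
    ‖w‖ = 1 ∧ ∀ s ∈ Icc c t, g s = g t + (s - t) • w := by
  have key : ∀ r ∈ Ioo c t, ‖w‖ = 1 ∧ ∀ s ∈ Icc r t, g s = g t + (s - t) • w := by
    intro r hr
    have hrt : 0 < t - r := by linarith [hr.2]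
    set e := (t - r)⁻¹ • (g t - g r) with he
    have hge : ∀ s ∈ Icc r t, g s = g t + (s - t) • e := by
      intro s hs
      have hrt' := hdist r t hr.1 hr.2.le le_rfl
      have h1 : dist (g r) (g s) = ((s - r) / (t - r)) * dist (g r) (g t) := by
        rw [hrt', hdist r s hr.1 hs.1 hs.2, div_mul_cancel₀ _ hrt.ne']
      have h2 : dist (g s) (g t) = (1 - (s - r) / (t - r)) * dist (g r) (g t) := by
        rw [hrt', hdist s t (hr.1.trans_le hs.1) hs.2 le_rfl]
        field_simp
        ring
      rw [eq_lineMap_of_dist_eq_mul_of_dist_eq_mul h1 h2, AffineMap.lineMap_apply_module, he,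
        smul_smul]
      have h3 : (s - t) * (t - r)⁻¹ = (s - r) / (t - r) - 1 := by
        field_simp
        ring
      rw [h3]
      module
    have hder : HasDerivWithinAt g e (Iic t) t := by
      have hlin : HasDerivAt (fun s : ℝ => g t + (s - t) • e) e t := by
        simpa using (((hasDerivAt_id t).sub_const t).smul_const e).const_add (g t)
      refine hlin.hasDerivWithinAt.congr_of_eventuallyEq ?_ (by simp)
      filter_upwards [Icc_mem_nhdsLE hr.2] with s hs using hge s hs
    have hwe : w = e := (uniqueDiffWithinAt_Iic t).eq_deriv _ hw.hasDerivWithinAt hder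
    refine ⟨?_, hwe ▸ hge⟩
    rw [hwe, he, norm_smul, ← dist_eq_norm, dist_comm, hdist r t hr.1 hr.2.le le_rfl, norm_inv,
      Real.norm_of_nonneg hrt.le, inv_mul_cancel₀ hrt.ne']
  obtain ⟨r, hr⟩ := nonempty_Ioo.2 hct
  refine ⟨(key r hr).1, ?_⟩
  have heq : EqOn g (fun s => g t + (s - t) • w) (Ioo c t) := fun s hs =>
    (key s hs).2 s ⟨le_rfl, hs.2.le⟩
  have := heq.closure hcont (by fun_prop)
  rwa [closure_Ioo hct.ne] at this

theorem norm_add_smul_sq {E : Type*} [NormedAddCommGroup E] [InnerProductSpace ℝ E]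
    (x w : E) (u : ℝ) :
    ‖x + u • w‖ ^ 2 = ‖x‖ ^ 2 + 2 * u * inner ℝ x w + u ^ 2 * ‖w‖ ^ 2 := by
  rw [norm_add_sq_real, inner_smul_right, norm_smul, mul_pow, Real.norm_eq_abs, sq_abs]
  ring

/-- If `‖·‖` increases along a unit speed segment and its line meets the open unit ball, then the
initial point lies between the terminal point and a point of the open unit ball. -/
theorem initial_mem_of_norm_strictMonoOn {E : Type*} [NormedAddCommGroup E]
    [InnerProductSpace ℝ E] {C : Set E} (hC : Convex ℝ C) (hball : Metric.ball (0 : E) 1 ⊆ C)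
    {g : ℝ → E} {c t : ℝ} (hct : c < t) {w : E} (hw : ‖w‖ = 1)
    (hg : ∀ s ∈ Icc c t, g s = g t + (s - t) • w)
    (hmono : StrictMonoOn (fun s => ‖g s‖) (Icc c t)) (hgt : g t ∈ C)
    {u : ℝ} (hu : ‖g t + u • w‖ < 1) : g c ∈ C := by
  set m : ℝ := inner ℝ (g t) w with hm
  have hsq : ∀ s ∈ Icc c t, ‖g s‖ ^ 2 = ‖g t‖ ^ 2 + 2 * (s - t) * m + (s - t) ^ 2 := by
    intro s hs
    rw [hg s hs, norm_add_smul_sq, hw]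
    ring
  have hx : 0 ≤ m + (c - t) := by
    by_contra! hneg
    set s := min t (c - (m + (c - t))) with hs
    have hcs : c < s := lt_min hct (by linarith)
    have hst : s ≤ t := min_le_left _ _
    have hs2 : s ≤ c - (m + (c - t)) := min_le_right _ _
    have hlt : ‖g c‖ < ‖g s‖ := hmono ⟨le_rfl, hct.le⟩ ⟨hcs.le, hst⟩ hcs
    have hlt2 : ‖g c‖ ^ 2 < ‖g s‖ ^ 2 := by gcongr
    rw [hsq s ⟨hcs.le, hst⟩, hsq c ⟨le_rfl, hct.le⟩] at hlt2
    nlinarith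
  have hmpos : 0 < m := by linarith
  have hfoot : g t - m • w ∈ C := by
    apply hball
    rw [mem_ball_zero_iff]
    have h1 : ‖g t + (-m) • w‖ ^ 2 ≤ ‖g t + u • w‖ ^ 2 := by
      rw [norm_add_smul_sq, norm_add_smul_sq, ← hm, hw]
      nlinarith [sq_nonneg (u + m)]
    have h2 := (pow_le_pow_iff_left₀ (norm_nonneg _) (norm_nonneg _) two_ne_zero).1 h1
    rw [neg_smul, ← sub_eq_add_neg] at h2
    exact h2.trans_lt hu
  have := hC.add_smul_sub_mem hgt hfoot (t := (t - c) / m)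
    ⟨div_nonneg (by linarith) hmpos.le, (div_le_one hmpos).2 (by linarith)⟩
  rw [hg c ⟨le_rfl, hct.le⟩]
  convert this using 2
  rw [sub_sub_cancel_left, smul_neg, smul_smul, div_mul_cancel₀ _ hmpos.ne', ← neg_smul, neg_sub]

theorem straight_of_tangent_meets_ball {E : Type*} [NormedAddCommGroup E]
    [InnerProductSpace ℝ E] {C : Set E} (hC : Convex ℝ C) (hCo : IsOpen C)
    (hball : Metric.ball (0 : E) 1 ⊆ C)
    {g : ℝ → E} (hcont : Continuous g) {a t : ℝ} (hat : a < t)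
    (hdist : ∀ p q, a < p → p ≤ q → q ≤ t → (∀ s ∈ Icc p q, g s ∈ C) → dist (g p) (g q) = q - p)
    (hmono : StrictMonoOn (fun s => ‖g s‖) (Icc a t)) (hgt : g t ∈ C)
    {w : E} (hw : HasDerivAt g w t) {u : ℝ} (hu : ‖g t + u • w‖ < 1) :
    ‖w‖ = 1 ∧ ∀ s ∈ Icc a t, g s = g t + (s - t) • w := by
  have hline : ∀ c ∈ Ico a t, (∀ s ∈ Ioc c t, g s ∈ C) →
      ‖w‖ = 1 ∧ ∀ s ∈ Icc c t, g s = g t + (s - t) • w := fun c hc hin =>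
    eq_add_smul_of_dist_eq hc.2 hcont (fun p q hp hpq hq => hdist p q (hc.1.trans_lt hp) hpq hq
      fun s hs => hin s ⟨hp.trans_le hs.1, hs.2.trans hq⟩) hw
  have hin : ∀ s ∈ Icc a t, g s ∈ C := by
    by_contra! hne
    have hcpt : IsCompact (Icc a t ∩ g ⁻¹' Cᶜ) :=
      isCompact_Icc.inter_right (hCo.isClosed_compl.preimage hcont)
    obtain ⟨c, ⟨hc, hcC⟩, hmax⟩ := hcpt.exists_isGreatest hne
    have hct : c < t := hc.2.lt_of_ne fun h => hcC (h ▸ hgt)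
    have hin : ∀ s ∈ Ioc c t, g s ∈ C := fun s hs => by
      by_contra hsC
      exact absurd (hmax ⟨⟨hc.1.trans hs.1.le, hs.2⟩, hsC⟩) (not_le.2 hs.1)
    obtain ⟨hw1, hg⟩ := hline c ⟨hc.1, hct⟩ hin
    exact hcC (initial_mem_of_norm_strictMonoOn hC hball hct hw1 hg
      (hmono.mono (Icc_subset_Icc_left hc.1)) hgt hu)
  exact hline a ⟨le_rfl, hat⟩ fun s hs => hin s ⟨hs.1.le, hs.2⟩

/-- The radial projection of a spatial curve to the unit sphere. -/
def radialProj (g : ℝ → E3) : ℝ → E3 := fun s => ‖g s‖⁻¹ • g s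

theorem radialProj_lipschitzOnWith {g : ℝ → E3} (hg : LipschitzWith 1 g) {p q δ : ℝ} (hδ : 0 < δ)
    (hδg : ∀ s ∈ Icc p q, δ ≤ ‖g s‖) :
    LipschitzOnWith (Real.toNNReal (2 / δ)) (radialProj g) (Icc p q) := by
  refine LipschitzOnWith.of_dist_le_mul fun x hx y hy => ?_
  rw [Real.coe_toNNReal _ (by positivity)]
  have hxp : 0 < ‖g x‖ := hδ.trans_le (hδg x hx)
  have hyp : 0 < ‖g y‖ := hδ.trans_le (hδg y hy)
  have hlip : ‖g x - g y‖ ≤ dist x y := by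
    simpa [dist_eq_norm] using hg.dist_le_mul x y
  have hsplit : radialProj g x - radialProj g y =
      ‖g x‖⁻¹ • (g x - g y) + (‖g x‖⁻¹ * ((‖g y‖ - ‖g x‖) * ‖g y‖⁻¹)) • g y := by
    have : ‖g x‖⁻¹ * ((‖g y‖ - ‖g x‖) * ‖g y‖⁻¹) = ‖g x‖⁻¹ - ‖g y‖⁻¹ := by field_simp
    rw [this]
    simp only [radialProj]
    module
  rw [dist_eq_norm, hsplit]
  calc _ ≤ ‖g x‖⁻¹ * ‖g x - g y‖ + ‖g x‖⁻¹ * (|‖g y‖ - ‖g x‖| * ‖g y‖⁻¹) * ‖g y‖ := by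
        refine (norm_add_le _ _).trans (le_of_eq ?_)
        simp [norm_smul]
    _ = ‖g x‖⁻¹ * (‖g x - g y‖ + |‖g y‖ - ‖g x‖|) := by field_simp
    _ ≤ δ⁻¹ * (dist x y + dist x y) := by
        have h1 : |‖g y‖ - ‖g x‖| ≤ dist x y := by
          rw [abs_sub_comm]
          exact (abs_norm_sub_norm_le _ _).trans hlip
        have h2 : ‖g x‖⁻¹ ≤ δ⁻¹ := inv_anti₀ hδ (hδg x hx)
        gcongr
    _ = 2 / δ * dist x y := by ring

theorem LipschitzOnWith.intervalIntegrable_norm_deriv {E : Type*} [NormedAddCommGroup E]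
    [NormedSpace ℝ E] [CompleteSpace E] {f : ℝ → E} {C : NNReal} {p q : ℝ}
    (hf : LipschitzOnWith C f (Icc p q)) (hpq : p ≤ q) :
    IntervalIntegrable (fun s => ‖deriv f s‖) volume p q := by
  rw [intervalIntegrable_iff_integrableOn_Ioo_of_le hpq]
  refine Measure.integrableOn_of_bounded (M := C) (by simp)
    (stronglyMeasurable_deriv f).norm.aestronglyMeasurable ?_
  filter_upwards [ae_restrict_mem measurableSet_Ioo] with s hs
  rw [norm_norm]
  exact norm_deriv_le_of_lipschitzOn (Icc_mem_nhds hs.1 hs.2) hf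

theorem LipschitzOnWith.integral_norm_deriv_le {E : Type*} [NormedAddCommGroup E]
    [NormedSpace ℝ E] {f : ℝ → E} {C : NNReal} {p q : ℝ}
    (hf : LipschitzOnWith C f (Icc p q)) (hpq : p ≤ q) :
    ∫ s in p..q, ‖deriv f s‖ ≤ C * (q - p) := by
  have h := intervalIntegral.norm_integral_le_of_norm_le_const_ae (a := p) (b := q) (C := (C : ℝ))
    (f := fun s => ‖deriv f s‖) ?_
  · rw [abs_of_nonneg (by linarith)] at h
    exact (Real.le_norm_self _).trans h
  · have hq : ∀ᵐ s : ℝ, s ≠ q := by simp [ae_iff]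
    filter_upwards [hq] with s hsq hs
    rw [uIoc_of_le hpq] at hs
    rw [norm_norm]
    exact norm_deriv_le_of_lipschitzOn (Icc_mem_nhds hs.1 (hs.2.lt_of_ne hsq)) hf

/-- The chord of a Lipschitz curve is at most its arclength. -/
theorem LipschitzOnWith.norm_sub_le_integral_norm_deriv {E : Type*} [NormedAddCommGroup E]
    [InnerProductSpace ℝ E] [FiniteDimensional ℝ E] {f : ℝ → E} {C : NNReal} {p q : ℝ}
    (hf : LipschitzOnWith C f (Icc p q)) (hpq : p ≤ q) :
    ‖f q - f p‖ ≤ ∫ s in p..q, ‖deriv f s‖ := by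
  rcases eq_or_ne (f q - f p) 0 with h0 | h0
  · rw [h0, norm_zero]
    exact intervalIntegral.integral_nonneg hpq fun _ _ => norm_nonneg _
  set e := ‖f q - f p‖⁻¹ • (f q - f p) with he
  have hnorm : ‖f q - f p‖ ≠ 0 := norm_ne_zero_iff.2 h0
  have he1 : ‖e‖ = 1 := by
    rw [he, norm_smul, norm_inv, norm_norm, inv_mul_cancel₀ hnorm]
  have hlip : LipschitzOnWith (‖innerSL ℝ e‖₊ * C) (fun s => inner ℝ e (f s)) (Icc p q) :=
    (innerSL ℝ e).lipschitz.comp_lipschitzOnWith hf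
  have hAC : AbsolutelyContinuousOnInterval (fun s => inner ℝ e (f s)) p q :=
    LipschitzOnWith.absolutelyContinuousOnInterval (by rwa [uIcc_of_le hpq])
  have hint := hAC.integral_deriv_eq_sub
  have hval : inner ℝ e (f q) - inner ℝ e (f p) = ‖f q - f p‖ := by
    rw [← inner_sub_right, he, real_inner_smul_left, real_inner_self_eq_norm_sq]
    field_simp
  rw [← hval, ← hint]
  refine intervalIntegral.integral_mono_ae_restrict hpq hAC.intervalIntegrable_deriv
    (hf.intervalIntegrable_norm_deriv hpq) ?_
  have hp : ∀ᵐ s : ℝ, s ≠ p := by simp [ae_iff]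
  have hq : ∀ᵐ s : ℝ, s ≠ q := by simp [ae_iff]
  filter_upwards [ae_restrict_mem measurableSet_Icc, ae_restrict_of_ae hp, ae_restrict_of_ae hq,
    ae_restrict_of_ae hf.ae_differentiableWithinAt_of_mem_real] with s hs hsp hsq hdiff
  have hd : DifferentiableAt ℝ f s := (hdiff hs).differentiableAt
    (Icc_mem_nhds (hs.1.lt_of_ne hsp.symm) (hs.2.lt_of_ne hsq))
  have hd' : HasDerivAt (fun s => inner ℝ e (f s)) (inner ℝ e (deriv f s)) s :=
    (innerSL ℝ e).hasFDerivAt.comp_hasDerivAt s hd.hasDerivAt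
  rw [hd'.deriv]
  simpa [he1] using real_inner_le_norm e (deriv f s)

theorem norm_sub_sq_eq_radialProj {g : ℝ → E3} {s t : ℝ} (hs : g s ≠ 0) (ht : g t ≠ 0) :
    ‖g s - g t‖ ^ 2 =
      (‖g s‖ - ‖g t‖) ^ 2 + ‖g s‖ * ‖g t‖ * ‖radialProj g s - radialProj g t‖ ^ 2 := by
  have hs' : ‖g s‖ ≠ 0 := norm_ne_zero_iff.2 hs
  have ht' : ‖g t‖ ≠ 0 := norm_ne_zero_iff.2 ht
  have h1 : ∀ x : ℝ, g x ≠ 0 → ‖radialProj g x‖ = 1 := fun x hx => by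
    rw [radialProj, norm_smul, norm_inv, norm_norm, inv_mul_cancel₀ (norm_ne_zero_iff.2 hx)]
  rw [norm_sub_sq_real, norm_sub_sq_real, h1 s hs, h1 t ht, radialProj, radialProj,
    real_inner_smul_left, real_inner_smul_right]
  field_simp
  ring

theorem norm_polar_sub_sq (r₁ r₂ α β : ℝ) :
    ‖(r₁ : ℂ) * Complex.exp (Complex.I * α) - r₂ * Complex.exp (Complex.I * β)‖ ^ 2 =
      (r₁ - r₂) ^ 2 + r₁ * r₂ * (2 - 2 * Real.cos (β - α)) := by
  rw [← Complex.normSq_eq_norm_sq, Complex.normSq_apply, mul_comm Complex.I, mul_comm Complex.I,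
    Complex.exp_mul_I, Complex.exp_mul_I, Real.cos_sub]
  simp [← Complex.ofReal_cos, ← Complex.ofReal_sin]
  linear_combination (r₁ ^ 2) * Real.cos_sq_add_sin_sq α + (r₂ ^ 2) * Real.cos_sq_add_sin_sq β

theorem sq_le_two_sub_two_cos_add {x : ℝ} (hx : |x| ≤ 1) :
    x ^ 2 ≤ 2 - 2 * Real.cos x + x ^ 4 := by
  have h := (abs_le.1 (Real.cos_bound hx)).2
  have : |x| ^ 4 = x ^ 4 := by
    rw [show (4 : ℕ) = 2 * 2 by rfl, pow_mul, pow_mul, sq_abs]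
  rw [this] at h
  nlinarith [sq_nonneg (x ^ 2)]

/-- Unfolding does not decrease the speed. -/
theorem norm_deriv_le_of_unfolding {g : ℝ → E3} {σ : ℝ → ℂ} {φ : ℝ → ℝ} {c t C : ℝ} (hct : c < t)
    (hσ : ∀ s ∈ Icc c t, σ s = (‖g s‖ : ℂ) * Complex.exp (Complex.I * φ s))
    (hne : ∀ s ∈ Icc c t, g s ≠ 0) (hle : ∀ s ∈ Icc c t, ‖g s‖ ≤ ‖g t‖)
    (harc : ∀ s ∈ Icc c t, ‖radialProj g s - radialProj g t‖ ≤ |φ t - φ s|)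
    (hC : ∀ s ∈ Icc c t, |φ t - φ s| ≤ C * (t - s))
    {v : ℂ} (hv : HasDerivAt σ v t) {w : E3} (hw : HasDerivAt g w t) : ‖w‖ ≤ ‖v‖ := by
  have hC0 : 0 ≤ C := by
    have := (abs_nonneg _).trans (hC c ⟨le_rfl, hct.le⟩)
    exact nonneg_of_mul_nonneg_left this (by linarith)
  have hmem : ∀ᶠ s in nhdsWithin t (Iio t), s ∈ Icc c t ∧ C * (t - s) ≤ 1 := by
    have h1 : ∀ᶠ s in nhdsWithin t (Iio t), s ∈ Icc c t :=
      Filter.mem_of_superset (Ico_mem_nhdsLT hct) Ico_subset_Icc_self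
    have h2 : Filter.Tendsto (fun s => C * (t - s)) (nhdsWithin t (Iio t)) (nhds 0) := by
      have : Continuous fun s => C * (t - s) := by fun_prop
      simpa using (this.tendsto t).mono_left nhdsWithin_le_nhds
    filter_upwards [h1, h2.eventually_le_const one_pos] with s h1 h2 using ⟨h1, h2⟩
  have hbound : ∀ᶠ s in nhdsWithin t (Iio t),
      ‖slope g t s‖ ^ 2 ≤ ‖slope σ t s‖ ^ 2 + ‖g t‖ ^ 2 * C ^ 4 * (s - t) ^ 2 := by
    filter_upwards [hmem, self_mem_nhdsWithin] with s ⟨hs, hs1⟩ hst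
    have hst' : 0 < t - s := by simpa using hst
    have ht : t ∈ Icc c t := ⟨hct.le, le_rfl⟩
    have hΔ := hC s hs
    have h1 : ‖g s - g t‖ ^ 2 ≤ ‖σ s - σ t‖ ^ 2 + ‖g t‖ ^ 2 * (C ^ 4 * (t - s) ^ 4) := by
      rw [norm_sub_sq_eq_radialProj (hne s hs) (hne t ht), hσ s hs, hσ t ht, norm_polar_sub_sq]
      have h2 : ‖radialProj g s - radialProj g t‖ ^ 2 ≤ (φ t - φ s) ^ 2 := by
        rw [← sq_abs (φ t - φ s)]
        exact pow_le_pow_left₀ (norm_nonneg _) (harc s hs) 2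
      have h3 := sq_le_two_sub_two_cos_add (hΔ.trans hs1)
      have h4 : (φ t - φ s) ^ 4 ≤ C ^ 4 * (t - s) ^ 4 := by
        rw [← mul_pow, ← Even.pow_abs (by decide)]
        exact pow_le_pow_left₀ (abs_nonneg _) hΔ 4
      have h5 : ‖g s‖ * ‖g t‖ ≤ ‖g t‖ ^ 2 := by
        nlinarith [hle s hs, norm_nonneg (g t)]
      have h6 : ‖g s‖ * ‖g t‖ * ‖radialProj g s - radialProj g t‖ ^ 2 ≤
          ‖g s‖ * ‖g t‖ * (2 - 2 * Real.cos (φ t - φ s) + C ^ 4 * (t - s) ^ 4) :=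
        mul_le_mul_of_nonneg_left (by linarith) (by positivity)
      have h7 : ‖g s‖ * ‖g t‖ * (C ^ 4 * (t - s) ^ 4) ≤ ‖g t‖ ^ 2 * (C ^ 4 * (t - s) ^ 4) :=
        mul_le_mul_of_nonneg_right h5 (by positivity)
      linarith
    rw [slope_def_module, slope_def_module, norm_smul, norm_smul, mul_pow, mul_pow, norm_inv,
      Real.norm_eq_abs, inv_pow, sq_abs]
    have hsq : 0 < (s - t) ^ 2 := by nlinarith
    calc ((s - t) ^ 2)⁻¹ * ‖g s - g t‖ ^ 2
        ≤ ((s - t) ^ 2)⁻¹ * (‖σ s - σ t‖ ^ 2 + ‖g t‖ ^ 2 * (C ^ 4 * (t - s) ^ 4)) := by gcongr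
      _ = _ := by
        have : (t - s) ^ 4 = (s - t) ^ 2 * (s - t) ^ 2 := by ring
        rw [this]
        field_simp
  have hlim1 := ((hasDerivWithinAt_iff_tendsto_slope' (self_notMem_Iio)).1
    (hw.hasDerivWithinAt (s := Iio t))).norm.pow 2
  have hlim2 := ((hasDerivWithinAt_iff_tendsto_slope' (self_notMem_Iio)).1
    (hv.hasDerivWithinAt (s := Iio t))).norm.pow 2
  have hlim3 : Filter.Tendsto (fun s => ‖g t‖ ^ 2 * C ^ 4 * (s - t) ^ 2) (nhdsWithin t (Iio t))
      (nhds 0) := by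
    have : Continuous fun s => ‖g t‖ ^ 2 * C ^ 4 * (s - t) ^ 2 := by fun_prop
    simpa using (this.tendsto t).mono_left nhdsWithin_le_nhds
  have h := le_of_tendsto_of_tendsto hlim1 (hlim2.add hlim3) hbound
  rw [add_zero] at h
  exact (pow_le_pow_iff_left₀ (norm_nonneg _) (norm_nonneg _) two_ne_zero).1 h

theorem inner_deriv_eq_of_norm_eq {E F : Type*} [NormedAddCommGroup E] [InnerProductSpace ℝ E]
    [NormedAddCommGroup F] [InnerProductSpace ℝ F] {g : ℝ → E} {σ : ℝ → F} {c t : ℝ} (hct : c < t)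
    (hnorm : ∀ s ∈ Ioc c t, ‖g s‖ = ‖σ s‖) {v : F} (hv : HasDerivAt σ v t) {w : E}
    (hw : HasDerivAt g w t) : inner ℝ (g t) w = inner ℝ (σ t) v := by
  have h1 := hw.norm_sq.hasDerivWithinAt (s := Iic t)
  have h2 := hv.norm_sq.hasDerivWithinAt (s := Iic t)
  have h3 : HasDerivWithinAt (fun s => ‖g s‖ ^ 2) (2 * inner ℝ (σ t) v) (Iic t) t := by
    refine h2.congr_of_eventuallyEq ?_ (by rw [hnorm t ⟨hct, le_rfl⟩])
    filter_upwards [Ioc_mem_nhdsLE hct] with s hs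
    rw [hnorm s hs]
  have := (uniqueDiffWithinAt_Iic t).eq_deriv _ h1 h3
  linarith

theorem norm_add_smul_lt_one_of_le {E F : Type*} [NormedAddCommGroup E] [InnerProductSpace ℝ E]
    [NormedAddCommGroup F] [InnerProductSpace ℝ F] {x w : E} {y v : F} {u : ℝ}
    (hxy : ‖x‖ = ‖y‖) (hin : inner ℝ x w = inner ℝ y v) (hle : ‖w‖ ≤ ‖v‖)
    (hu : ‖y + u • v‖ < 1) : ‖x + u • w‖ < 1 := by
  refine lt_of_le_of_lt ?_ hu
  refine (pow_le_pow_iff_left₀ (norm_nonneg _) (norm_nonneg _) two_ne_zero).1 ?_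
  rw [norm_add_smul_sq, norm_add_smul_sq, hxy, hin]
  gcongr

/-- The angular speed of a unit speed line seen from the origin. -/
theorem norm_deriv_radialProj_line {g : ℝ → E3} {a t : ℝ} {w : E3} (hw : ‖w‖ = 1)
    (hg : ∀ s ∈ Icc a t, g s = g t + (s - t) • w) {m h : ℝ} (hm : m = inner ℝ (g t) w)
    (hh : 0 ≤ h) (hsq : ‖g t‖ ^ 2 = m ^ 2 + h ^ 2) {s : ℝ} (hs : s ∈ Ioo a t) (hne : g s ≠ 0) :
    ‖deriv (radialProj g) s‖ = h / ((m + (s - t)) ^ 2 + h ^ 2) := by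
  have hev : g =ᶠ[nhds s] fun s => g t + (s - t) • w := by
    filter_upwards [Icc_mem_nhds hs.1 hs.2] with x hx using hg x hx
  have hgd : HasDerivAt g w s := by
    have hlin : HasDerivAt (fun s : ℝ => g t + (s - t) • w) w s := by
      simpa using (((hasDerivAt_id s).sub_const t).smul_const w).const_add (g t)
    exact hlin.congr_of_eventuallyEq hev
  have hgs := hg s ⟨hs.1.le, hs.2.le⟩
  have hin : inner ℝ (g s) w = m + (s - t) := by
    rw [hgs, inner_add_left, real_inner_smul_left, real_inner_self_eq_norm_sq, hw, hm]
    ring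
  have hnsq : ‖g s‖ ^ 2 = (m + (s - t)) ^ 2 + h ^ 2 := by
    rw [hgs, norm_add_smul_sq, hw, ← hm, hsq]
    ring
  set x := m + (s - t) with hx
  set r := ‖g s‖ with hr
  have hr0 : 0 < r := norm_pos_iff.2 hne
  have hnorm : HasDerivAt (fun s => ‖g s‖) (x / r) s := by
    have h1 := hgd.norm_sq.sqrt (by positivity)
    simp only [Real.sqrt_sq (norm_nonneg _)] at h1
    rw [hin] at h1
    convert h1 using 1
    rw [← hr]
    field_simp
  have hder : HasDerivAt (radialProj g) (r⁻¹ • w + (-(x / r) / r ^ 2) • g s) s :=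
    (hnorm.inv hr0.ne').smul hgd
  rw [hder.deriv, ← hnsq]
  have hq : ‖r⁻¹ • w + (-(x / r) / r ^ 2) • g s‖ ^ 2 = (h / r ^ 2) ^ 2 := by
    rw [norm_add_smul_sq, norm_smul, real_inner_smul_left, real_inner_comm, hin, hw, ← hr, norm_inv,
      Real.norm_of_nonneg hr0.le]
    have hh2 : h ^ 2 = r ^ 2 - x ^ 2 := by linarith
    rw [div_pow h, hh2]
    field_simp
    ring
  exact (pow_left_inj₀ (norm_nonneg _) (by positivity) two_ne_zero).1 hq

/-- The planar curve with the polar coordinates of a unit speed line is a line. -/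
theorem polar_line {m h ε t p φ₀ : ℝ} (hε : ε = 1 ∨ ε = -1)
    (hpos : ∀ s ∈ Icc p t, 0 < (m + (s - t)) ^ 2 + h ^ 2) :
    ∃ c : ℂ, ∀ s ∈ Icc p t,
      (√((m + (s - t)) ^ 2 + h ^ 2) : ℂ) * Complex.exp (Complex.I *
        ((φ₀ - ε * ∫ x in s..t, h / ((m + (x - t)) ^ 2 + h ^ 2) : ℝ) : ℂ)) =
      c * (((m + (s - t) : ℝ) : ℂ) - Complex.I * ((ε * h : ℝ) : ℂ)) := by
  set k : ℝ → ℝ := fun x => h / ((m + (x - t)) ^ 2 + h ^ 2) with hk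
  set ζ : ℝ → ℂ := fun s => ((m + (s - t) : ℝ) : ℂ) - Complex.I * ((ε * h : ℝ) : ℂ) with hζ
  set ρ : ℝ → ℝ := fun s => √((m + (s - t)) ^ 2 + h ^ 2) with hρ
  set Φ : ℝ → ℝ := fun s => φ₀ - ε * ∫ x in s..t, k x with hΦ
  have hε2 : ε ^ 2 = 1 := by rcases hε with rfl | rfl <;> norm_num
  have hkc : Continuous k := by
    rcases eq_or_ne h 0 with h0 | h0
    · simp only [hk, h0, zero_div]
      exact continuous_const
    · exact continuous_const.div (by fun_prop) fun x => by positivity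
  have hζ0 : ∀ s ∈ Icc p t, ζ s ≠ 0 := by
    intro s hs h0
    have hre := congrArg Complex.re h0
    have him := congrArg Complex.im h0
    simp [hζ] at hre him
    have := hpos s hs
    have hεh : h = 0 := by
      rcases him with h | h
      · simp [h] at hε2
      · exact h
    rw [hre, hεh] at this
    simp at this
  have hζd : ∀ s, HasDerivAt ζ 1 s := fun s => by
    have : HasDerivAt (fun s : ℝ => m + (s - t)) 1 s := ((hasDerivAt_id s).sub_const t).const_add m
    exact (this.ofReal_comp.sub_const (Complex.I * ((ε * h : ℝ) : ℂ))).congr_deriv (by simp)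
  have hΦd : ∀ s, HasDerivAt Φ (ε * k s) s := fun s => by
    have h1 := intervalIntegral.integral_hasDerivAt_left (hkc.intervalIntegrable s t)
      (hkc.stronglyMeasurableAtFilter _ _) hkc.continuousAt
    exact ((h1.const_mul ε).const_sub φ₀).congr_deriv (by ring)
  have hρd : ∀ s ∈ Icc p t, HasDerivAt ρ ((m + (s - t)) / ρ s) s := fun s hs => by
    have : HasDerivAt (fun s : ℝ => m + (s - t)) 1 s := ((hasDerivAt_id s).sub_const t).const_add m
    have h1 := ((this.pow 2).add_const (h ^ 2)).sqrt (hpos s hs).ne'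
    refine h1.congr_deriv ?_
    have hρ0 : 0 < ρ s := Real.sqrt_pos.2 (hpos s hs)
    change (2 : ℕ) * (m + (s - t)) ^ (2 - 1) * 1 / (2 * ρ s) = _
    field_simp
    simp [mul_comm]
  have hD : ∀ s ∈ Icc p t,
      HasDerivAt (fun s => (ρ s : ℂ) * Complex.exp (Complex.I * (Φ s : ℂ)) / ζ s) 0 s := by
    intro s hs
    have h1 := ((hρd s hs).ofReal_comp.mul
      (((hΦd s).ofReal_comp.const_mul Complex.I).cexp)).div (hζd s) (hζ0 s hs)
    refine h1.congr_deriv ?_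
    have hρ0 : 0 < ρ s := Real.sqrt_pos.2 (hpos s hs)
    have hρ2 : ρ s ^ 2 = (m + (s - t)) ^ 2 + h ^ 2 := Real.sq_sqrt (hpos s hs).le
    have hks : k s = h / ρ s ^ 2 := by rw [hρ2]
    have hρc : (ρ s : ℂ) ≠ 0 := by exact_mod_cast hρ0.ne'
    have hρ2c : (ρ s : ℂ) ^ 2 = (m + (s - t)) ^ 2 + h ^ 2 := by exact_mod_cast hρ2
    have hε2c : (ε : ℂ) ^ 2 = 1 := by exact_mod_cast hε2
    rw [hks, _root_.div_eq_zero_iff]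
    left
    simp only [hζ, Pi.mul_apply]
    push_cast
    field_simp
    linear_combination (-Complex.exp (Complex.I * (Φ s : ℂ))) * hρ2c +
      (Complex.exp (Complex.I * (Φ s : ℂ)) * h ^ 2) * hε2c -
      (Complex.exp (Complex.I * (Φ s : ℂ)) * ε ^ 2 * h ^ 2) * Complex.I_sq
  have hconst := constant_of_has_deriv_right_zero
    (fun s hs => (hD s hs).continuousAt.continuousWithinAt)
    (fun s hs => (hD s (Ico_subset_Icc_self hs)).hasDerivWithinAt)
  exact ⟨_, fun s hs => (div_eq_iff (hζ0 s hs)).1 (hconst s hs)⟩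

/-- The unfolding of a unit speed segment is a segment. -/
theorem unfolding_of_line {g : ℝ → E3} {σ : ℝ → ℂ} {φ : ℝ → ℝ} {a t ε : ℝ}
    (hε : ε = 1 ∨ ε = -1)
    (hσ : ∀ s ∈ Ioc a t, σ s = (‖g s‖ : ℂ) * Complex.exp (Complex.I * φ s))
    (hne : ∀ s ∈ Ioc a t, g s ≠ 0)
    (hφ : ∀ s ∈ Ioc a t, φ t - φ s = ε * ∫ x in s..t, ‖deriv (radialProj g) x‖)
    {w : E3} (hw : ‖w‖ = 1) (hg : ∀ s ∈ Icc a t, g s = g t + (s - t) • w)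
    {v : ℂ} (hv : HasDerivAt σ v t) {s : ℝ} (hs : s ∈ Ioc a t) :
    σ s = σ t + (s - t) • v := by
  rcases hs.2.eq_or_lt with rfl | hst
  · simp
  set m : ℝ := inner ℝ (g t) w with hm
  have hm2 : m ^ 2 ≤ ‖g t‖ ^ 2 := by
    have := abs_real_inner_le_norm (g t) w
    rw [hw, mul_one] at this
    exact sq_le_sq.2 (by rwa [abs_norm])
  set h := √(‖g t‖ ^ 2 - m ^ 2) with hh
  have hh0 : 0 ≤ h := Real.sqrt_nonneg _
  have hsq : ‖g t‖ ^ 2 = m ^ 2 + h ^ 2 := by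
    rw [hh, Real.sq_sqrt (by linarith)]
    ring
  have hmem : ∀ x ∈ Icc s t, x ∈ Ioc a t := fun x hx => ⟨hs.1.trans_le hx.1, hx.2⟩
  have hnsq : ∀ x ∈ Icc s t, ‖g x‖ ^ 2 = (m + (x - t)) ^ 2 + h ^ 2 := by
    intro x hx
    rw [hg x (Ioc_subset_Icc_self (hmem x hx)), norm_add_smul_sq, hw, ← hm, hsq]
    ring
  obtain ⟨c, hc⟩ := polar_line (m := m) (h := h) (t := t) (p := s) (φ₀ := φ t) hε fun x hx => by
    rw [← hnsq x hx]
    have := norm_pos_iff.2 (hne x (hmem x hx))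
    positivity
  have hσc : ∀ x ∈ Icc s t,
      σ x = c * (((m + (x - t) : ℝ) : ℂ) - Complex.I * ((ε * h : ℝ) : ℂ)) := by
    intro x hx
    rw [← hc x hx, hσ x (hmem x hx), ← hnsq x hx, Real.sqrt_sq (norm_nonneg _)]
    congr 4
    have hint : ∫ y in x..t, ‖deriv (radialProj g) y‖ =
        ∫ y in x..t, h / ((m + (y - t)) ^ 2 + h ^ 2) := by
      refine intervalIntegral.integral_congr_ae ?_
      have hyt : ∀ᵐ y : ℝ, y ≠ t := by simp [ae_iff]
      filter_upwards [hyt] with y hyt hy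
      rw [uIoc_of_le hx.2] at hy
      have hya : a < y := hs.1.trans (hx.1.trans_lt hy.1)
      exact norm_deriv_radialProj_line hw hg hm hh0 hsq ⟨hya, hy.2.lt_of_ne hyt⟩
        (hne y ⟨hya, hy.2⟩)
    rw [← hint, ← hφ x (hmem x hx)]
    ring
  have hlin : ∀ x ∈ Icc s t, σ x = σ t + (x - t) • c := by
    intro x hx
    rw [hσc x hx, hσc t ⟨hst.le, le_rfl⟩, Complex.real_smul]
    push_cast
    ring
  have hder : HasDerivWithinAt σ c (Iic t) t := by
    have hl : HasDerivAt (fun x : ℝ => σ t + (x - t) • c) c t := by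
      simpa using (((hasDerivAt_id t).sub_const t).smul_const c).const_add (σ t)
    refine hl.hasDerivWithinAt.congr_of_eventuallyEq ?_ (by simp)
    filter_upwards [Icc_mem_nhdsLE hst] with x hx using hlin x hx
  rw [(uniqueDiffWithinAt_Iic t).eq_deriv _ hv.hasDerivWithinAt hder]
  exact hlin s ⟨le_rfl, hst.le⟩

/-- A planar curve on a ray from the origin lies on its tangent line. -/
theorem mem_tangent_of_radial {σ : ℝ → ℂ} {α a t : ℝ} (hat : a < t)
    (hcont : ContinuousOn σ (Icc a t))
    (hσ : ∀ s ∈ Ioc a t, σ s = (‖σ s‖ : ℂ) * Complex.exp (Complex.I * α))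
    {v : ℂ} (hv : HasDerivAt σ v t) (hv0 : v ≠ 0) {s : ℝ} (hs : s ∈ Icc a t) :
    ∃ u : ℝ, σ s = σ t + u • v := by
  have hc : IsClosed {s | s ∈ Icc a t ∧ σ s = (‖σ s‖ : ℂ) * Complex.exp (Complex.I * α)} := by
    refine isClosed_Icc.isClosed_eq hcont ?_
    exact (Complex.continuous_ofReal.comp_continuousOn hcont.norm).mul continuousOn_const
  have hσ' : ∀ s ∈ Icc a t, σ s = (‖σ s‖ : ℂ) * Complex.exp (Complex.I * α) := by
    intro s hs
    have := closure_minimal (s := Ioc a t) (fun s hs => And.intro (Ioc_subset_Icc_self hs) (hσ s hs)) hc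
    rw [closure_Ioc hat.ne] at this
    exact (this hs).2
  set e := Complex.exp (Complex.I * α) with he
  have he0 : e ≠ 0 := Complex.exp_ne_zero _
  have hderiv : HasDerivWithinAt (fun s => (σ s / e).im) ((v / e).im) (Iic t) t :=
    (Complex.imCLM.hasFDerivAt.comp_hasDerivAt t (hv.div_const e)).hasDerivWithinAt
  have hzero : HasDerivWithinAt (fun s => (σ s / e).im) 0 (Iic t) t := by
    have hz : ∀ s ∈ Icc a t, (σ s / e).im = 0 := fun s hs => by
      rw [hσ' s hs, mul_div_cancel_right₀ _ he0, Complex.ofReal_im]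
    refine (hasDerivWithinAt_const t (Iic t) (0 : ℝ)).congr_of_eventuallyEq ?_
      (hz t ⟨hat.le, le_rfl⟩)
    filter_upwards [Icc_mem_nhdsLE hat] with s hs using hz s hs
  have him : (v / e).im = 0 := (uniqueDiffWithinAt_Iic t).eq_deriv _ hderiv hzero
  set y := (v / e).re with hy
  have hve : v = y * e := by
    rw [← div_eq_iff he0]
    exact Complex.ext (by simp [hy]) (by simp [him])
  have hy0 : (y : ℂ) ≠ 0 := fun h => hv0 (by rw [hve, h, zero_mul])
  refine ⟨(‖σ s‖ - ‖σ t‖) / y, ?_⟩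
  rw [Complex.real_smul, hve, hσ' s hs, hσ' t ⟨hat.le, le_rfl⟩]
  push_cast
  simp only [norm_mul, Complex.norm_real, norm_norm]
  have : ‖e‖ = 1 := by rw [he, mul_comm, Complex.norm_exp_ofReal_mul_I]
  rw [this, mul_one, mul_one]
  field_simp
  ring

theorem exists_mem_Icc_of_partition {tk : ℕ → ℝ} {m : ℕ} (hm : 0 < m) {x : ℝ}
    (h0 : tk 0 ≤ x) (hx : x ≤ tk m) :
    ∃ k, 1 ≤ k ∧ k ≤ m ∧ x ∈ Icc (tk (k - 1)) (tk k) := by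
  classical
  have hex : ∃ k, 1 ≤ k ∧ x ≤ tk k := ⟨m, hm, hx⟩
  obtain ⟨h1, hle⟩ := Nat.find_spec hex
  refine ⟨Nat.find hex, h1, Nat.find_min' hex ⟨hm, hx⟩, ?_, hle⟩
  rcases h1.eq_or_lt with he | hlt
  · rwa [← he]
  · have := Nat.find_min hex (m := Nat.find hex - 1) (by omega)
    push Not at this
    exact (this (by omega)).le

theorem exists_subset_Icc_of_partition {tk : ℕ → ℝ} {m : ℕ} (hm : 0 < m) {J : Set ℝ}
    (hJ : J.OrdConnected) (hJL : J ⊆ Icc (tk 0) (tk m)) (hno : ∀ k, 0 < k → k < m → tk k ∉ J)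
    (hne : J.Nonempty) : ∃ k, 1 ≤ k ∧ k ≤ m ∧ J ⊆ Icc (tk (k - 1)) (tk k) := by
  obtain ⟨x, hx⟩ := hne
  obtain ⟨k, hk1, hkm, hxk⟩ := exists_mem_Icc_of_partition hm (hJL hx).1 (hJL hx).2
  refine ⟨k, hk1, hkm, fun y hy => ⟨?_, ?_⟩⟩
  · by_contra! hlt
    have hk : k - 1 ≠ 0 := fun h => by
      rw [h] at hlt
      exact hlt.not_ge (hJL hy).1
    exact hno (k - 1) (by omega) (by omega) (hJ.out hy hx ⟨hlt.le, hxk.1⟩)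
  · by_contra! hlt
    have hk : k ≠ m := fun h => by
      rw [h] at hlt
      exact hlt.not_ge (hJL hy).2
    exact hno k (by omega) (by omega) (hJ.out hx hy ⟨hxk.2, hlt.le⟩)

theorem norm_ofReal_mul_exp_I_mul {r x : ℝ} (hr : 0 ≤ r) :
    ‖(r : ℂ) * Complex.exp (Complex.I * x)‖ = r := by
  rw [norm_mul, mul_comm Complex.I, Complex.norm_exp_ofReal_mul_I, mul_one, Complex.norm_real,
    Real.norm_of_nonneg hr]

/-- Since `thetaFn` is defined by an interval integral from `0`, either its increments compute the
arclength of the radial projection, or the integral diverges and `thetaFn` vanishes. -/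
theorem thetaFn_increment_or_eq_zero {L : ℝ} {γ : AddCircle L → E3} {ψ : ℝ → ℝ} {c a t : ℝ}
    (hψ : ψ = id ∨ ψ = fun s => c - s)
    (hint : ∀ s ∈ Ioc a t, IntervalIntegrable
      (fun x => ‖deriv (radialProj fun s => liftCurve L γ (ψ s)) x‖) volume s t) :
    (∃ ε : ℝ, (ε = 1 ∨ ε = -1) ∧ ∀ s ∈ Ioc a t, thetaFn L γ (ψ t) - thetaFn L γ (ψ s) =
      ε * ∫ x in s..t, ‖deriv (radialProj fun s => liftCurve L γ (ψ s)) x‖) ∨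
    ∀ s ∈ Ioc a t, thetaFn L γ (ψ s) = 0 := by
  set n := radialProj fun s => liftCurve L γ (ψ s) with hn
  have hII : ∀ s ∈ Ioc a t,
      IntervalIntegrable (fun x => ‖projDeriv L γ x‖) volume (ψ s) (ψ t) := by
    intro s hs
    rcases hψ with rfl | rfl
    · exact hint s hs
    · have h1 := (hint s hs).comp_sub_left c
      have hfun : (fun x => ‖deriv n (c - x)‖) = fun x => ‖projDeriv L γ x‖ := by
        funext x
        have : n = fun y => radialProj (liftCurve L γ) (c - y) := rfl
        rw [this, deriv_comp_const_sub, norm_neg, _root_.sub_sub_cancel]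
        rfl
      rwa [hfun] at h1
  have hval : ∃ ε : ℝ, (ε = 1 ∨ ε = -1) ∧ ∀ s,
      ∫ x in (ψ s)..(ψ t), ‖projDeriv L γ x‖ = ε * ∫ x in s..t, ‖deriv n x‖ := by
    rcases hψ with rfl | rfl
    · exact ⟨1, Or.inl rfl, fun s => by rw [one_mul]; rfl⟩
    · refine ⟨-1, Or.inr rfl, fun s => ?_⟩
      have hfun : ∀ x, ‖deriv n x‖ = ‖projDeriv L γ (c - x)‖ := by
        intro x
        have : n = fun y => radialProj (liftCurve L γ) (c - y) := rfl
        rw [this, deriv_comp_const_sub, norm_neg]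
        rfl
      simp only [hfun]
      rw [intervalIntegral.integral_comp_sub_left (fun x => ‖projDeriv L γ x‖) c,
        intervalIntegral.integral_symm]
      ring
  by_cases hP : IntervalIntegrable (fun x => ‖projDeriv L γ x‖) volume 0 (ψ t)
  · left
    obtain ⟨ε, hε, hval⟩ := hval
    refine ⟨ε, hε, fun s hs => ?_⟩
    rw [← hval s]
    exact intervalIntegral.integral_interval_sub_left hP (hP.trans (hII s hs).symm)
  · right
    intro s hs
    exact intervalIntegral.integral_undef fun h => hP (h.trans (hII s hs))

/-- Let `σ : [a,b] → ℝ²` be a strict spiral occurring in a spiral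
decomposition of the unfolding `γt` of a minimal inspection curve `γ` (so `σ = γt ∘ ψ`
on `[a,b]` where `ψ` is either the identity or the direction-reversing map `s ↦ a+b-s`
of the component with closure `[a,b]`, reparameterizing the component if necessary).
Let `t ∈ [a,b]` be a regular point of both `σ` and `γ`, and `ℓ = σ(t) + ℝ·v` the
tangent line of `σ` at `t`. If `ℓ` crosses the unit circle (meets the open unit disk),
then `σ([a,t])` lies on `ℓ`. -/
theorem spiral_tangent_line_segment
    (L : ℝ) (γ : AddCircle L → E3) (hγ : IsMinInspectionCurve L γ)
    (h0 : IsLocalMin (fun s : ℝ => ‖liftCurve L γ s‖) 0)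
    (γt : ℝ → ℂ) (hunf : IsUnfolding L γ γt)
    (ι : Type) (U : ι → Set ℝ) (hdec : IsSpiralDecomp L γt ι U)
    (i : ι) (a b : ℝ) (hcl : closure (U i) = Set.Icc a b)
    (σ : ℝ → ℂ) (ψ : ℝ → ℝ)
    (hψ : ψ = id ∨ ψ = fun s => a + b - s)
    (hσγ : ∀ s ∈ Set.Icc a b, σ s = γt (ψ s))
    (hσ : IsStrictSpiral σ a b)
    (t : ℝ) (ht : t ∈ Set.Icc a b)
    (v : ℂ) (hregσ : HasDerivAt σ v t) (hv : v ≠ 0)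
    (w : E3) (hregγ : HasDerivAt (liftCurve L γ) w (ψ t)) (hw : w ≠ 0)
    (hcross : ∃ u : ℝ, ‖σ t + u • v‖ < 1) :
    ∀ s ∈ Set.Icc a t, ∃ u : ℝ, σ s = σ t + u • v := by
  intro s₀ hs₀
  rcases ht.1.eq_or_lt with rfl | hat
  · exact ⟨0, by simp [le_antisymm hs₀.2 hs₀.1]⟩
  obtain ⟨⟨hab, hσc, -, -, -, -⟩, hstrict⟩ := hσ
  obtain ⟨m, tk, hm, htk, htk0, htkL, hzero, hγt⟩ := hunf
  have hsub : Icc a b ⊆ Icc 0 L := by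
    rw [← hcl]
    obtain ⟨V, -, hV⟩ := hdec.2.1 i
    exact closure_minimal (hV ▸ inter_subset_right) isClosed_Icc
  have ha0 : 0 ≤ a := (hsub ⟨le_rfl, hab.le⟩).1
  have hbL : b ≤ L := (hsub ⟨hab.le, le_rfl⟩).2
  have hψmem : ∀ s ∈ Icc a b, ψ s ∈ Icc 0 L := fun s hs => by
    rcases hψ with rfl | rfl
    · exact hsub hs
    · exact hsub ⟨by linarith [hs.2], by linarith [hs.1]⟩
  have htb : Icc a t ⊆ Icc a b := Icc_subset_Icc_right ht.2
  have hlip : LipschitzWith 1 (liftCurve L γ) := hγ.1.2.2.1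
  set g : ℝ → E3 := fun s => liftCurve L γ (ψ s) with hg
  have hglip : LipschitzWith 1 g := by
    rcases hψ with rfl | rfl
    · exact hlip
    · refine LipschitzWith.of_dist_le_mul fun x y => ?_
      have := hlip.dist_le_mul (a + b - x) (a + b - y)
      rwa [dist_sub_left] at this
  have hnorm : ∀ s ∈ Icc a b, ‖σ s‖ = ‖g s‖ := by
    intro s hs
    obtain ⟨k, hk1, hkm, hk⟩ := exists_mem_Icc_of_partition hm (htk0 ▸ (hψmem s hs).1)
      (htkL ▸ (hψmem s hs).2)
    rw [hσγ s hs, hγt k hk1 hkm _ hk, norm_ofReal_mul_exp_I_mul (norm_nonneg _)]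
  have hmono : StrictMonoOn (fun s => ‖g s‖) (Icc a t) := fun x hx y hy hxy => by
    have := hstrict (htb hx) (htb hy) hxy
    simpa only [hnorm x (htb hx), hnorm y (htb hy)] using this
  have hne : ∀ s ∈ Ioc a t, g s ≠ 0 := fun s hs => norm_pos_iff.1
    ((norm_nonneg _).trans_lt (hmono ⟨le_rfl, hat.le⟩ ⟨hs.1.le, hs.2⟩ hs.1))
  have hpiece : ∃ k, 1 ≤ k ∧ k ≤ m ∧ ψ '' Ioc a t ⊆ Icc (tk (k - 1)) (tk k) := by
    refine exists_subset_Icc_of_partition hm ?_ ?_ ?_ ⟨_, t, ⟨hat, le_rfl⟩, rfl⟩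
    · rcases hψ with rfl | rfl
      · rw [image_id]
        exact ordConnected_Ioc
      · rw [image_const_sub_Ioc]
        exact ordConnected_Ico
    · rw [htk0, htkL]
      rintro _ ⟨s, hs, rfl⟩
      exact hψmem s (htb (Ioc_subset_Icc_self hs))
    · rintro k hk0 hkm ⟨s, hs, hsk⟩
      refine hne s hs ?_
      have hk : tk k ∈ Ioo 0 L := by
        rw [← htk0, ← htkL]
        exact ⟨htk (by simp) (by simpa using hkm.le) hk0, htk (by simpa using hkm.le) (by simp) hkm⟩
      rw [hg]
      simp only [hsk]
      exact (hzero _ hk).2 ⟨k, hk0, hkm, rfl⟩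
  obtain ⟨k, hk1, hkm, hk⟩ := hpiece
  set φ : ℝ → ℝ := fun s => thetaFn L γ (ψ s) + ((k : ℝ) - 1) * π with hφ
  have hσφ : ∀ s ∈ Ioc a t, σ s = (‖g s‖ : ℂ) * Complex.exp (Complex.I * φ s) := fun s hs => by
    rw [hσγ s (htb (Ioc_subset_Icc_self hs)), hγt k hk1 hkm _ (hk ⟨s, hs, rfl⟩)]
  have hrad : ∀ s ∈ Ioc a t,
      LipschitzOnWith (Real.toNNReal (2 / ‖g s‖)) (radialProj g) (Icc s t) := fun s hs =>
    radialProj_lipschitzOnWith hglip (norm_pos_iff.2 (hne s hs)) fun x hx =>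
      hmono.monotoneOn ⟨hs.1.le, hs.2⟩ ⟨hs.1.le.trans hx.1, hx.2⟩ hx.1
  have hσct : ContinuousOn σ (Icc a t) := hσc.mono htb
  rcases thetaFn_increment_or_eq_zero hψ
    fun s hs => (hrad s hs).intervalIntegrable_norm_deriv hs.2 with ⟨ε, hε, hθ⟩ | hθ
  swap
  · refine mem_tangent_of_radial (α := ((k : ℝ) - 1) * π) hat hσct (fun s hs => ?_) hregσ hv hs₀
    rw [hnorm s (htb (Ioc_subset_Icc_self hs)), hσφ s hs, hφ]
    simp only [hθ s hs, zero_add]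
  have hφε : ∀ s ∈ Ioc a t, φ t - φ s = ε * ∫ x in s..t, ‖deriv (radialProj g) x‖ := by
    intro s hs
    rw [← hθ s hs, hφ]
    ring
  obtain ⟨w', hw'⟩ : ∃ w', HasDerivAt g w' t := by
    rcases hψ with rfl | rfl
    · exact ⟨w, hregγ⟩
    · exact ⟨-w, hregγ.comp_const_sub (a + b) t⟩
  obtain ⟨c, hc⟩ := nonempty_Ioo.2 hat
  have hcI : ∀ s ∈ Icc c t, s ∈ Ioc a t := fun s hs => ⟨hc.1.trans_le hs.1, hs.2⟩
  have habs : ∀ s ∈ Icc c t, |φ t - φ s| = ∫ x in s..t, ‖deriv (radialProj g) x‖ := by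
    intro s hs
    have hnn : 0 ≤ ∫ x in s..t, ‖deriv (radialProj g) x‖ :=
      intervalIntegral.integral_nonneg hs.2 fun _ _ => norm_nonneg _
    rw [hφε s (hcI s hs), abs_mul, abs_of_nonneg hnn]
    rcases hε with rfl | rfl <;> simp
  have hradc : ∀ s ∈ Icc c t,
      LipschitzOnWith (Real.toNNReal (2 / ‖g c‖)) (radialProj g) (Icc s t) := fun s hs =>
    (hrad c ⟨hc.1, hc.2.le⟩).mono (Icc_subset_Icc_left hs.1)
  have hwv : ‖w'‖ ≤ ‖v‖ := by
    refine norm_deriv_le_of_unfolding (C := Real.toNNReal (2 / ‖g c‖)) hc.2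
      (fun s hs => hσφ s (hcI s hs)) (fun s hs => hne s (hcI s hs))
      (fun s hs => ?_) (fun s hs => ?_) (fun s hs => ?_) hregσ hw'
    · exact hmono.monotoneOn (Ioc_subset_Icc_self (hcI s hs)) ⟨hat.le, le_rfl⟩ hs.2
    · rw [habs s hs, norm_sub_rev]
      exact (hradc s hs).norm_sub_le_integral_norm_deriv hs.2
    · rw [habs s hs]
      exact (hradc s hs).integral_norm_deriv_le hs.2
  have hinner : inner ℝ (g t) w' = inner ℝ (σ t) v := inner_deriv_eq_of_norm_eq hat
    (fun s hs => (hnorm s (htb (Ioc_subset_Icc_self hs))).symm) hregσ hw'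
  obtain ⟨u, hu⟩ := hcross
  have hu' : ‖g t + u • w'‖ < 1 := norm_add_smul_lt_one_of_le (hnorm t ht).symm hinner hwv hu
  have hball := ball_subset_interior_of_sphere_subset (convex_convexHull ℝ (range γ)) hγ.1.2.2.2.2
  have hgt : g t ∈ interior (convexHull ℝ (range γ)) :=
    mem_interior_of_tangent_meets (g := g) (convex_convexHull ℝ (range γ))
      (fun s => subset_convexHull ℝ _ (mem_range_self (ψ s : AddCircle L))) hw' (hball (by simpa using hu'))
  obtain ⟨hw1, hline⟩ := straight_of_tangent_meets_ball (convex_convexHull ℝ _).interior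
    isOpen_interior hball hglip.continuous hat (fun p q hp hpq hq hin => by
      rcases hψ with rfl | rfl
      · exact hγ.dist_eq_of_mem_interior (p := p) (q := q) (by linarith) hpq (by linarith [ht.2])
          (by linarith [ht.2]) hin
      · rw [dist_comm]
        have := hγ.dist_eq_of_mem_interior (p := a + b - q) (q := a + b - p) (by linarith [ht.2])
          (by linarith) (by linarith) (by linarith [ht.2]) fun s hs => by
            have := hin (a + b - s) ⟨by linarith [hs.2], by linarith [hs.1]⟩
            simpa only [hg, _root_.sub_sub_cancel] using this
        exact this.trans (by ring)) hmono hgt hw' hu'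
  have hσline : EqOn σ (fun s => σ t + (s - t) • v) (Ioc a t) := fun s hs =>
    unfolding_of_line hε hσφ hne hφε hw1 hline hregσ hs
  have hcl' : Icc a t ⊆ closure (Ioc a t) := by rw [closure_Ioc hat.ne]
  exact ⟨s₀ - t, hσline.of_subset_closure hσct (by fun_prop) Ioc_subset_Icc_self hcl' hs₀⟩
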